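/- In the bigraded setup below, assume in addition that f_1,…,f_k form a regular sequence in ℂ[z_1,…,z_{N+k+1}], that N+k+1 − (d_1+…+d_k) = 1, that 2 ≤ d_1 ≤ d_j for all j, and that f_1 = z_1^{d_1} + ⋯ + z_{N+k+1}^{d_1}. Then dim_ℂ R_{1,−1} = −(N+k+1) + ∑_{j=1}^{k} ∑_{I⊆{1,…,k}} (−1)^{k−|I|} C((∑_{s∈I} d_s) + d_j − 1, N+k). -/

import Mathlib

open MvPolynomial

noncomputable section

/-- The polynomial ring `S = ℂ[z_1,…,z_{N+k+1}, w_1,…,w_k]`. -/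
abbrev SRing (N k : ℕ) : Type := MvPolynomial (Fin (N + k + 1) ⊕ Fin k) ℂ

/-- The bigrading on `S`: `deg z_s = (0,1)` and `deg w_j = (1, -d_j)`. -/
def wt (N k : ℕ) (d : Fin k → ℕ) : Fin (N + k + 1) ⊕ Fin k → ℤ × ℤ :=
  Sum.elim (fun _ => ((0 : ℤ), (1 : ℤ))) (fun j => ((1 : ℤ), -(d j : ℤ)))

/-- `F = w_1 f_1 + ⋯ + w_k f_k ∈ S`. -/
def bigF (N k : ℕ) (f : Fin k → MvPolynomial (Fin (N + k + 1)) ℂ) : SRing N k :=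
  ∑ j : Fin k, X (Sum.inr j) * rename Sum.inl (f j)

/-- The ideal `J(F)` generated by all the partial derivatives of `F`. -/
def Jfull (N k : ℕ) (f : Fin k → MvPolynomial (Fin (N + k + 1)) ℂ) : Ideal (SRing N k) :=
  Ideal.span (Set.range fun v : Fin (N + k + 1) ⊕ Fin k => pderiv v (bigF N k f))

/-- The ideal `J'(F)` generated by `∂F/∂w_1, …, ∂F/∂w_k` alone. -/
def Jprime (N k : ℕ) (f : Fin k → MvPolynomial (Fin (N + k + 1)) ℂ) : Ideal (SRing N k) :=
  Ideal.span (Set.range fun j : Fin k => pderiv (Sum.inr j) (bigF N k f))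

lemma Jprime_le_Jfull (N k : ℕ) (f : Fin k → MvPolynomial (Fin (N + k + 1)) ℂ) :
    Jprime N k f ≤ Jfull N k f :=
  Ideal.span_mono (by rintro x ⟨j, rfl⟩; exact ⟨Sum.inr j, rfl⟩)

/-- The bidegree-`(p,q)` component of `S`. -/
def Scomp (N k : ℕ) (d : Fin k → ℕ) (p q : ℤ) : Submodule ℂ (SRing N k) :=
  weightedHomogeneousSubmodule ℂ (wt N k d) (p, q)

/-- The bidegree-`(p,q)` component of `R = S/J(F)`. -/
def Rcomp (N k : ℕ) (d : Fin k → ℕ) (f : Fin k → MvPolynomial (Fin (N + k + 1)) ℂ)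
    (p q : ℤ) : Submodule ℂ (SRing N k ⧸ Jfull N k f) :=
  Submodule.map (Ideal.Quotient.mkₐ ℂ (Jfull N k f)).toLinearMap (Scomp N k d p q)

/-- The bidegree-`(p,q)` component of `R' = S/J'(F)`. -/
def R'comp (N k : ℕ) (d : Fin k → ℕ) (f : Fin k → MvPolynomial (Fin (N + k + 1)) ℂ)
    (p q : ℤ) : Submodule ℂ (SRing N k ⧸ Jprime N k f) :=
  Submodule.map (Ideal.Quotient.mkₐ ℂ (Jprime N k f)).toLinearMap (Scomp N k d p q)

/-- `f 0, …, f (k-1)` is a regular sequence: each `f i` is a nonzerodivisor modulo the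
ideal generated by the previous ones. -/
def IsRegularSeq {m k : ℕ} (f : Fin k → MvPolynomial (Fin m) ℂ) : Prop :=
  ∀ i : Fin k, ∀ p : MvPolynomial (Fin m) ℂ,
    f i * p ∈ Ideal.span (f '' {j : Fin k | j < i}) →
      p ∈ Ideal.span (f '' {j : Fin k | j < i})

section HilbertFunction

variable {σ K : Type*} [Field K]

attribute [local instance] MvPolynomial.gradedAlgebra

lemma finrank_homogeneousSubmodule_fin (m q : ℕ) :
    Module.finrank K (homogeneousSubmodule (Fin (m + 1)) K q) = (m + q).choose m := by
  rw [homogeneousSubmodule_eq_finsupp_supported,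
    (AddMonoidAlgebra.supportedEquivFinsupp _).finrank_eq]
  have h : {d : Fin (m + 1) →₀ ℕ | d.degree = q} =
      ((Finset.univ : Finset (Fin (m + 1))).finsuppAntidiag q : Set _) := by
    ext d
    simp [Finsupp.degree_eq_sum]
  rw [h, Module.finrank_finsupp_self]
  simp only [Finset.coe_sort_coe, Fintype.card_coe]
  rw [Finset.card_finsuppAntidiag_nat_eq_choose, Finset.card_fin,
    show m + 1 + q - 1 = m + q by omega, Nat.choose_symm_add]

instance finite_homogeneousSubmodule [Finite σ] (q : ℕ) :
    Module.Finite K (homogeneousSubmodule σ K q) :=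
  Module.Finite.iff_fg.mpr (homogeneousSubmodule_fg σ K q)

lemma homogeneousComponent_mul_of_isHomogeneous {e : ℕ} {g : MvPolynomial σ K}
    (hg : g.IsHomogeneous e) (p : MvPolynomial σ K) (q : ℕ) :
    homogeneousComponent q (p * g) =
      if e ≤ q then homogeneousComponent (q - e) p * g else 0 := by
  have h := DirectSum.coe_decompose_mul_of_right_mem (homogeneousSubmodule σ K) (a := p) q
    ((mem_homogeneousSubmodule e g).mpr hg)
  have key : ∀ (r : MvPolynomial σ K) (i : ℕ),
      (DirectSum.decompose (homogeneousSubmodule σ K) r i : MvPolynomial σ K) =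
        homogeneousComponent i r := fun r i => decomposition.decompose'_apply r i
  rwa [key, key] at h

/-- The dimension of the degree `q` part of `K[σ] / I`, for a homogeneous ideal `I`. -/
def hilbertFunction (I : Ideal (MvPolynomial σ K)) (q : ℕ) : ℤ :=
  Module.finrank K (homogeneousSubmodule σ K q) -
    Module.finrank K ↥(I.restrictScalars K ⊓ homogeneousSubmodule σ K q)

lemma sup_span_singleton_inf_homogeneousSubmodule {I : Ideal (MvPolynomial σ K)}
    (hI : I.IsHomogeneous (homogeneousSubmodule σ K)) {e : ℕ} {g : MvPolynomial σ K}
    (hg : g.IsHomogeneous e) (q : ℕ) :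
    (I ⊔ Ideal.span {g}).restrictScalars K ⊓ homogeneousSubmodule σ K q =
      if e ≤ q then I.restrictScalars K ⊓ homogeneousSubmodule σ K q ⊔
        (homogeneousSubmodule σ K (q - e)).map (LinearMap.mulRight K g)
      else I.restrictScalars K ⊓ homogeneousSubmodule σ K q := by
  have hle : I.restrictScalars K ⊓ homogeneousSubmodule σ K q ≤
      (I ⊔ Ideal.span {g}).restrictScalars K ⊓ homogeneousSubmodule σ K q :=
    inf_le_inf_right _ fun x hx => Ideal.mem_sup_left hx
  have hge : ∀ x ∈ (I ⊔ Ideal.span {g}).restrictScalars K ⊓ homogeneousSubmodule σ K q,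
      ∃ a ∈ I.restrictScalars K ⊓ homogeneousSubmodule σ K q, ∃ b : MvPolynomial σ K,
        x = a + if e ≤ q then homogeneousComponent (q - e) b * g else 0 := by
    rintro x ⟨hx, hxq⟩
    obtain ⟨a, ha, c, hc, rfl⟩ := Submodule.mem_sup.mp hx
    obtain ⟨b, rfl⟩ := Ideal.mem_span_singleton'.mp hc
    refine ⟨homogeneousComponent q a, ⟨homogeneousComponent_mem_of_mem hI ha q,
      homogeneousComponent_mem q a⟩, b, ?_⟩
    rw [← homogeneousComponent_mul_of_isHomogeneous hg, ← map_add]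
    exact (homogeneousComponent_eq_self hxq).symm
  split_ifs with h
  · apply le_antisymm
    · intro x hx
      obtain ⟨a, ha, b, rfl⟩ := hge x hx
      rw [if_pos h]
      exact Submodule.add_mem_sup ha ⟨_, homogeneousComponent_mem _ b, rfl⟩
    · refine sup_le hle ?_
      rintro _ ⟨b, hb, rfl⟩
      refine ⟨Ideal.mem_sup_right (Ideal.mul_mem_left _ _ (Ideal.mem_span_singleton_self g)), ?_⟩
      have := IsHomogeneous.mul hb hg
      rwa [Nat.sub_add_cancel h] at this
  · refine le_antisymm (fun x hx => ?_) hle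
    obtain ⟨a, ha, b, rfl⟩ := hge x hx
    simpa [h] using ha

lemma hilbertFunction_sup_span_singleton [Finite σ] {I : Ideal (MvPolynomial σ K)}
    (hI : I.IsHomogeneous (homogeneousSubmodule σ K)) {e : ℕ} {g : MvPolynomial σ K}
    (hg : g.IsHomogeneous e) (hg0 : g ≠ 0) (hreg : ∀ p, g * p ∈ I → p ∈ I) (q : ℕ) :
    hilbertFunction (I ⊔ Ideal.span {g}) q =
      hilbertFunction I q - if e ≤ q then hilbertFunction I (q - e) else 0 := by
  unfold hilbertFunction
  rw [sup_span_singleton_inf_homogeneousSubmodule hI hg]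
  by_cases h : e ≤ q
  · rw [if_pos h, if_pos h]
    have hinj : Function.Injective (LinearMap.mulRight K g) := mul_left_injective₀ hg0
    have hinf : I.restrictScalars K ⊓ homogeneousSubmodule σ K q ⊓
        (homogeneousSubmodule σ K (q - e)).map (LinearMap.mulRight K g) =
        (I.restrictScalars K ⊓ homogeneousSubmodule σ K (q - e)).map
          (LinearMap.mulRight K g) := by
      ext x
      constructor
      · rintro ⟨⟨hx, -⟩, b, hb, rfl⟩
        exact ⟨b, ⟨hreg b (by rw [mul_comm]; exact hx), hb⟩, rfl⟩
      · rintro ⟨b, ⟨hbI, hb⟩, rfl⟩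
        refine ⟨⟨Ideal.mul_mem_right _ _ hbI, ?_⟩, b, hb, rfl⟩
        have := IsHomogeneous.mul hb hg
        rwa [Nat.sub_add_cancel h] at this
    have hfin (p : ℕ) : Module.Finite K
        ↥(I.restrictScalars K ⊓ homogeneousSubmodule σ K p) :=
      Submodule.finiteDimensional_of_le inf_le_right
    have hdim := Submodule.finrank_sup_add_finrank_inf_eq
      (I.restrictScalars K ⊓ homogeneousSubmodule σ K q)
      ((homogeneousSubmodule σ K (q - e)).map (LinearMap.mulRight K g))
    rw [hinf, (Submodule.equivMapOfInjective _ hinj _).finrank_eq.symm,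
      (Submodule.equivMapOfInjective _ hinj _).finrank_eq.symm] at hdim
    omega
  · rw [if_neg h, if_neg h, sub_zero]

end HilbertFunction

section RegularSequence

attribute [local instance] MvPolynomial.gradedAlgebra

lemma isHomogeneous_span_image {σ ι K : Type*} [Field K] {d : ι → ℕ}
    {f : ι → MvPolynomial σ K} (hf : ∀ j, (f j).IsHomogeneous (d j)) (s : Set ι) :
    (Ideal.span (f '' s)).IsHomogeneous (homogeneousSubmodule σ K) := by
  apply Ideal.homogeneous_span
  rintro _ ⟨j, -, rfl⟩
  exact ⟨d j, hf j⟩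

lemma IsRegularSeq.ne_zero {m k : ℕ} {f : Fin k → MvPolynomial (Fin m) ℂ}
    (hreg : IsRegularSeq f) {d : Fin k → ℕ} (hf : ∀ j, (f j).IsHomogeneous (d j))
    (hd : ∀ j, 1 ≤ d j) (i : Fin k) : f i ≠ 0 := by
  intro h0
  have hle : Ideal.span (f '' {j | j < i}) ≤
      RingHom.ker (constantCoeff : MvPolynomial (Fin m) ℂ →+* ℂ) := by
    rw [Ideal.span_le]
    rintro _ ⟨j, -, rfl⟩
    exact (hf j).coeff_eq_zero (by simpa using (Nat.one_le_iff_ne_zero.mp (hd j)).symm)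
  have h1 := hle (hreg i 1 (by simp [h0]))
  simp at h1

lemma IsRegularSeq.hilbertFunction_span_image {m k : ℕ} {f : Fin k → MvPolynomial (Fin m) ℂ}
    (hreg : IsRegularSeq f) {d : Fin k → ℕ} (hf : ∀ j, (f j).IsHomogeneous (d j))
    (hd : ∀ j, 1 ≤ d j) {i : ℕ} (hi : i ≤ k) (q : ℕ) :
    hilbertFunction (Ideal.span (f '' {j | (j : ℕ) < i})) q =
      ∑ J ∈ (Finset.univ.filter fun j : Fin k => (j : ℕ) < i).powerset,
        (-1 : ℤ) ^ J.card * if ∑ s ∈ J, d s ≤ q then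
          (Module.finrank ℂ (homogeneousSubmodule (Fin m) ℂ (q - ∑ s ∈ J, d s)) : ℤ) else 0 := by
  induction i generalizing q with
  | zero =>
    have h0 : {j : Fin k | (j : ℕ) < 0} = ∅ := by simp
    rw [h0, Set.image_empty, Ideal.span_empty, hilbertFunction, Submodule.restrictScalars_bot,
      bot_inf_eq]
    simp
    rfl
  | succ i ih =>
    have hset : {j : Fin k | (j : ℕ) < i + 1} = insert ⟨i, hi⟩ {j : Fin k | (j : ℕ) < i} := by
      ext j
      simp [Fin.ext_iff, le_iff_eq_or_lt]
    have hfin : (Finset.univ.filter fun j : Fin k => (j : ℕ) < i + 1) =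
        insert ⟨i, hi⟩ (Finset.univ.filter fun j : Fin k => (j : ℕ) < i) := by
      ext j
      simp [Fin.ext_iff, le_iff_eq_or_lt]
    have hstep := hilbertFunction_sup_span_singleton
      (isHomogeneous_span_image hf {j : Fin k | (j : ℕ) < i}) (hf ⟨i, hi⟩)
      (hreg.ne_zero hf hd _) (hreg ⟨i, hi⟩) q
    rw [hset, Set.image_insert_eq, Ideal.span_insert, sup_comm, hstep, hfin,
      Finset.sum_powerset_insert (by simp), ih (by omega), ih (by omega), sub_eq_add_neg]
    congr 1
    have hins : ∀ J ∈ (Finset.univ.filter fun j : Fin k => (j : ℕ) < i).powerset,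
        (⟨i, hi⟩ : Fin k) ∉ J := fun J hJ hmem => by
      simpa using Finset.mem_powerset.mp hJ hmem
    split_ifs with h
    · rw [← Finset.sum_neg_distrib]
      refine Finset.sum_congr rfl fun J hJ => ?_
      rw [Finset.card_insert_of_notMem (hins J hJ), Finset.sum_insert (hins J hJ), pow_succ,
        Nat.sub_sub]
      simp only [Nat.le_sub_iff_add_le' h]
      ring
    · rw [neg_zero, eq_comm]
      refine Finset.sum_eq_zero fun J hJ => ?_
      rw [Finset.sum_insert (hins J hJ), if_neg (by omega), mul_zero]

/-- The Hilbert function of a complete intersection in `n + 1` variables whose degrees sum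
to `n`, written as an alternating sum of binomial coefficients. -/
lemma IsRegularSeq.hilbertFunction_eq_sum_choose {n k : ℕ}
    {f : Fin k → MvPolynomial (Fin (n + 1)) ℂ} (hreg : IsRegularSeq f) {d : Fin k → ℕ}
    (hf : ∀ j, (f j).IsHomogeneous (d j)) (hd : ∀ j, 1 ≤ d j) (hsum : ∑ j, d j = n) (q : ℕ) :
    hilbertFunction (Ideal.span (Set.range f)) q =
      ∑ I ∈ (Finset.univ : Finset (Fin k)).powerset,
        (-1 : ℤ) ^ (k - I.card) * ((∑ s ∈ I, d s) + q).choose n := by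
  have h := hreg.hilbertFunction_span_image hf hd le_rfl q
  have hset : {j : Fin k | (j : ℕ) < k} = Set.univ := by simp
  have hfin : (Finset.univ.filter fun j : Fin k => (j : ℕ) < k) = Finset.univ := by simp
  rw [hset, Set.image_univ, hfin] at h
  rw [h, Finset.powerset_univ]
  refine Finset.sum_nbij' (fun J => Jᶜ) (fun J => Jᶜ) (by simp) (by simp) (by simp) (by simp)
    fun J _ => ?_
  have hc := Finset.sum_add_sum_compl J d
  have hcard := Finset.card_add_card_compl J
  rw [Fintype.card_fin] at hcard
  rw [show k - Jᶜ.card = J.card by omega]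
  congr 1
  split_ifs with hle
  · rw [finrank_homogeneousSubmodule_fin]
    congr 2
    omega
  · rw [Nat.choose_eq_zero_of_lt (by omega), Nat.cast_zero]

end RegularSequence

section LinearInW

variable {N k : ℕ}

/-- The linear form `w_1 g_1 + ⋯ + w_k g_k` with coefficients `g`. -/
def linearInW (N k : ℕ) : (Fin k → MvPolynomial (Fin (N + k + 1)) ℂ) →ₗ[ℂ] SRing N k where
  toFun g := ∑ j, X (Sum.inr j) * rename Sum.inl (g j)
  map_add' g h := by simp [mul_add, Finset.sum_add_distrib]
  map_smul' c g := by simp [Finset.smul_sum]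

lemma linearInW_apply (g : Fin k → MvPolynomial (Fin (N + k + 1)) ℂ) :
    linearInW N k g = ∑ j, X (Sum.inr j) * rename Sum.inl (g j) := rfl

/-- The substitution `w = 0`. -/
def evalW (N k : ℕ) : SRing N k →ₐ[ℂ] MvPolynomial (Fin (N + k + 1)) ℂ :=
  aeval (Sum.elim X 0)

@[simp]
lemma evalW_rename (p : MvPolynomial (Fin (N + k + 1)) ℂ) :
    evalW N k (rename Sum.inl p) = p := by
  rw [evalW, aeval_rename, Sum.elim_comp_inl, aeval_X_left_apply]

@[simp]
lemma evalW_X_inr (j : Fin k) : evalW N k (X (Sum.inr j)) = 0 := by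
  simp [evalW]

lemma pderiv_inr_rename_inl (j : Fin k) (p : MvPolynomial (Fin (N + k + 1)) ℂ) :
    pderiv (Sum.inr j : Fin (N + k + 1) ⊕ Fin k) (rename Sum.inl p) = 0 := by
  refine pderiv_eq_zero_of_notMem_vars fun h => ?_
  obtain ⟨s, -, hs⟩ := Finset.mem_image.mp (vars_rename Sum.inl p h)
  exact Sum.inl_ne_inr hs

lemma pderiv_inr_linearInW (j : Fin k) (g : Fin k → MvPolynomial (Fin (N + k + 1)) ℂ) :
    pderiv (Sum.inr j) (linearInW N k g) = rename Sum.inl (g j) := by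
  simp [linearInW_apply, pderiv_inr_rename_inl, pderiv_X, Pi.single_apply]

lemma pderiv_inl_linearInW (s : Fin (N + k + 1))
    (g : Fin k → MvPolynomial (Fin (N + k + 1)) ℂ) :
    pderiv (Sum.inl s) (linearInW N k g) = linearInW N k fun j => pderiv s (g j) := by
  simp [linearInW_apply, pderiv_rename Sum.inl_injective]

lemma evalW_linearInW (g : Fin k → MvPolynomial (Fin (N + k + 1)) ℂ) :
    evalW N k (linearInW N k g) = 0 := by
  simp [linearInW_apply]

lemma evalW_pderiv_linearInW (j : Fin k) (g : Fin k → MvPolynomial (Fin (N + k + 1)) ℂ) :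
    evalW N k (pderiv (Sum.inr j) (linearInW N k g)) = g j := by
  rw [pderiv_inr_linearInW, evalW_rename]

lemma bigF_eq_linearInW (f : Fin k → MvPolynomial (Fin (N + k + 1)) ℂ) :
    bigF N k f = linearInW N k f := rfl

lemma rename_mem_Jfull {f : Fin k → MvPolynomial (Fin (N + k + 1)) ℂ}
    {p : MvPolynomial (Fin (N + k + 1)) ℂ} (hp : p ∈ Ideal.span (Set.range f)) :
    rename Sum.inl p ∈ Jfull N k f := by
  have hle : Ideal.span (Set.range f) ≤
      (Jfull N k f).comap (rename Sum.inl : _ →ₐ[ℂ] SRing N k) := by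
    rw [Ideal.span_le]
    rintro _ ⟨j, rfl⟩
    refine Ideal.subset_span ⟨Sum.inr j, ?_⟩
    exact pderiv_inr_linearInW j f
  exact hle hp

lemma evalW_pderiv_of_mem_Jfull {f : Fin k → MvPolynomial (Fin (N + k + 1)) ℂ}
    {a : SRing N k} (ha : a ∈ Jfull N k f) :
    evalW N k a ∈ Ideal.span (Set.range f) ∧
      ∃ b : Fin (N + k + 1) → MvPolynomial (Fin (N + k + 1)) ℂ, ∀ j,
        evalW N k (pderiv (Sum.inr j) a) - ∑ s, b s * pderiv s (f j) ∈
          Ideal.span (Set.range f) := by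
  induction ha using Submodule.span_induction with
  | mem x hx =>
    obtain ⟨s | i, rfl⟩ := hx
    · simp only [bigF_eq_linearInW, pderiv_inl_linearInW, evalW_linearInW,
        evalW_pderiv_linearInW]
      exact ⟨zero_mem _, Pi.single s 1, fun j => by simp [Pi.single_apply]⟩
    · simp only [bigF_eq_linearInW, pderiv_inr_linearInW, evalW_rename, pderiv_inr_rename_inl]
      exact ⟨Ideal.subset_span ⟨i, rfl⟩, 0, fun j => by simp⟩
  | zero => exact ⟨by simp, 0, fun j => by simp⟩
  | add x y _ _ hx hy =>
    obtain ⟨hx, b, hb⟩ := hx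
    obtain ⟨hy, c, hc⟩ := hy
    refine ⟨by rw [map_add]; exact add_mem hx hy, b + c, fun j => ?_⟩
    convert add_mem (hb j) (hc j) using 1
    simp only [map_add, Pi.add_apply, add_mul, Finset.sum_add_distrib]
    ring
  | smul r x _ hx =>
    obtain ⟨hx, b, hb⟩ := hx
    refine ⟨by rw [smul_eq_mul, map_mul]; exact Ideal.mul_mem_left _ _ hx,
      fun s => evalW N k r * b s, fun j => ?_⟩
    convert add_mem (Ideal.mul_mem_left _ (evalW N k r) (hb j))
      (Ideal.mul_mem_right (evalW N k (pderiv (Sum.inr j) r)) _ hx) using 1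
    simp only [smul_eq_mul, pderiv_mul, map_add, map_mul, mul_assoc, ← Finset.mul_sum]
    ring

lemma linearInW_mem_Jfull_iff {f g : Fin k → MvPolynomial (Fin (N + k + 1)) ℂ} :
    linearInW N k g ∈ Jfull N k f ↔
      ∃ b : Fin (N + k + 1) → MvPolynomial (Fin (N + k + 1)) ℂ, ∀ j,
        g j - ∑ s, b s * pderiv s (f j) ∈ Ideal.span (Set.range f) := by
  constructor
  · intro h
    simpa only [evalW_pderiv_linearInW] using (evalW_pderiv_of_mem_Jfull h).2
  · rintro ⟨b, hb⟩
    have hg : linearInW N k g =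
        ∑ j, X (Sum.inr j) * rename Sum.inl (g j - ∑ s, b s * pderiv s (f j)) +
          ∑ s, rename Sum.inl (b s) * pderiv (Sum.inl s) (bigF N k f) := by
      simp only [bigF_eq_linearInW, pderiv_inl_linearInW]
      simp only [linearInW_apply, map_sub, map_sum, map_mul, mul_sub, Finset.sum_sub_distrib,
        Finset.mul_sum]
      rw [Finset.sum_comm (s := (Finset.univ : Finset (Fin (N + k + 1))))]
      simp only [mul_left_comm, sub_add_cancel]
    rw [hg]
    exact add_mem (sum_mem fun j _ => Ideal.mul_mem_left _ _ (rename_mem_Jfull (hb j)))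
      (sum_mem fun s _ => Ideal.mul_mem_left _ _ (Ideal.subset_span ⟨Sum.inl s, rfl⟩))

lemma weight_wt (d : Fin k → ℕ) (e : Fin (N + k + 1) ⊕ Fin k →₀ ℕ) :
    Finsupp.weight (wt N k d) e =
      (((∑ j, e (Sum.inr j) : ℕ) : ℤ),
        ((∑ s, e (Sum.inl s) : ℕ) : ℤ) - ∑ j, (e (Sum.inr j) : ℤ) * d j) := by
  rw [Finsupp.weight_eq_sum, Fintype.sum_sum_type]
  ext <;> simp [wt, Prod.fst_sum, Prod.snd_sum, sub_eq_add_neg]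

lemma isWeightedHomogeneous_rename {d : Fin k → ℕ} {q : ℕ}
    {p : MvPolynomial (Fin (N + k + 1)) ℂ} (hp : p.IsHomogeneous q) :
    IsWeightedHomogeneous (wt N k d) (rename Sum.inl p) ((0 : ℤ), (q : ℤ)) := by
  intro e he
  obtain ⟨u, rfl, hu⟩ := coeff_rename_ne_zero _ _ _ he
  have hq : u.degree = q := by
    by_contra h
    exact hu (hp.coeff_eq_zero h)
  rw [weight_wt]
  simp [Finsupp.mapDomain_apply Sum.inl_injective, Finsupp.mapDomain_of_notMem_range,
    ← hq, Finsupp.degree_eq_sum]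

lemma Scomp_one_neg_one {d : Fin k → ℕ} (hd : ∀ j, 1 ≤ d j) :
    Scomp N k d 1 (-1) = (Submodule.pi Set.univ fun j =>
      homogeneousSubmodule (Fin (N + k + 1)) ℂ (d j - 1)).map (linearInW N k) := by
  apply le_antisymm
  · intro p hp
    induction hp using IsWeightedHomogeneous.induction_on with
    | zero => exact zero_mem _
    | add p q _ _ hp hq => exact add_mem hp hq
    | monomial e c he =>
      rw [weight_wt, Prod.mk.injEq] at he
      obtain ⟨h1, h2⟩ := he
      norm_cast at h1
      have hw : (Finsupp.equivFunOnFinite.symm fun j => e (Sum.inr j)).sum (fun _ n ↦ n) = 1 := by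
        rw [Finsupp.sum_fintype _ _ (by simp)]
        exact h1
      obtain ⟨j, hj⟩ := (Finsupp.sum_eq_one_iff _).mp hw
      have he (i : Fin k) : e (Sum.inr i) = Finsupp.single j 1 i := DFunLike.congr_fun hj i
      set u : Fin (N + k + 1) →₀ ℕ := Finsupp.equivFunOnFinite.symm fun s => e (Sum.inl s) with hu
      refine ⟨Pi.single j (monomial u c), fun i _ => ?_, ?_⟩
      · rcases eq_or_ne i j with rfl | hij
        · rw [Pi.single_eq_same]
          refine isHomogeneous_monomial c ?_
          have := hd i
          simp [he, Finsupp.single_apply] at h2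
          rw [Finsupp.degree_eq_sum]
          simp only [hu, Finsupp.coe_equivFunOnFinite_symm]
          zify [this]
          linarith
        · rw [Pi.single_eq_of_ne hij]
          exact zero_mem _
      · have hu_add : Finsupp.single (Sum.inr j) 1 + u.mapDomain Sum.inl = e := by
          ext (s | i)
          · simp [hu, Finsupp.mapDomain_apply Sum.inl_injective]
          · simp [he, Finsupp.mapDomain_of_notMem_range, Finsupp.single_apply]
        rw [linearInW_apply, Finset.sum_eq_single j (fun i _ hij => by simp [hij]) (by simp),
          Pi.single_eq_same, rename_monomial, X, monomial_mul, one_mul,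
          hu_add]
  · rintro _ ⟨g, hg, rfl⟩
    rw [linearInW_apply]
    refine sum_mem fun j _ => ?_
    have h := (isWeightedHomogeneous_X ℂ (wt N k d) (Sum.inr j)).mul
      (isWeightedHomogeneous_rename (d := d) (hg j trivial))
    have hwt : wt N k d (Sum.inr j) + ((0 : ℤ), ((d j - 1 : ℕ) : ℤ)) = (1, -1) := by
      simp [wt, Nat.cast_sub (hd j)]
      ring
    rwa [hwt] at h

end LinearInW

section Jacobian

attribute [local instance] MvPolynomial.gradedAlgebra

/-- The linear equivalence between a product of submodules, as a submodule of the product,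
and the product of the corresponding modules. -/
def submodulePiEquiv {ι K : Type*} [Field K] {M : ι → Type*} [∀ i, AddCommGroup (M i)]
    [∀ i, Module K (M i)] (p : ∀ i, Submodule K (M i)) :
    Submodule.pi Set.univ p ≃ₗ[K] ∀ i, p i where
  toFun x i := ⟨x.1 i, x.2 i trivial⟩
  invFun y := ⟨fun i => y i, fun i _ => (y i).2⟩
  map_add' _ _ := rfl
  map_smul' _ _ := rfl

lemma finrank_submodule_pi {ι K : Type*} [Fintype ι] [Field K] {M : ι → Type*}
    [∀ i, AddCommGroup (M i)] [∀ i, Module K (M i)] (p : ∀ i, Submodule K (M i))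
    [∀ i, Module.Finite K (p i)] :
    Module.finrank K (Submodule.pi Set.univ p) = ∑ i, Module.finrank K (p i) := by
  rw [(submodulePiEquiv p).finrank_eq, Module.finrank_pi_fintype]

lemma finrank_map_add_finrank_inf_ker {K V W : Type*} [Field K] [AddCommGroup V] [Module K V]
    [AddCommGroup W] [Module K W] (φ : V →ₗ[K] W) (U : Submodule K V) [Module.Finite K U] :
    Module.finrank K (U.map φ) + Module.finrank K ↥(U ⊓ LinearMap.ker φ) =
      Module.finrank K U := by
  rw [← LinearMap.finrank_range_add_finrank_ker (φ.domRestrict U), LinearMap.range_domRestrict,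
    LinearMap.ker_domRestrict, ← (Submodule.comapSubtypeEquivOfLe inf_le_left).finrank_eq,
    Submodule.comap_inf, Submodule.comap_subtype_self, top_inf_eq]

lemma homogeneousComponent_eq_zero_of_mem_span {σ ι K : Type*} [Field K] [Fintype ι]
    {d : ι → ℕ} {f : ι → MvPolynomial σ K} (hf : ∀ j, (f j).IsHomogeneous (d j)) {q : ℕ}
    (hq : ∀ j, q < d j) {p : MvPolynomial σ K} (hp : p ∈ Ideal.span (Set.range f)) :
    homogeneousComponent q p = 0 := by
  obtain ⟨c, rfl⟩ := Ideal.mem_span_range_iff_exists_fun.mp hp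
  rw [map_sum]
  refine Finset.sum_eq_zero fun j _ => ?_
  rw [homogeneousComponent_mul_of_isHomogeneous (hf j), if_neg (hq j).not_ge]

lemma eq_zero_of_sum_smul_pderiv_mem_span {ι : Type*} [Fintype ι] {m : ℕ} {d : ι → ℕ}
    {f : ι → MvPolynomial (Fin m) ℂ} (hf : ∀ j, (f j).IsHomogeneous (d j)) {i : ι}
    (hi : 2 ≤ d i) (hmin : ∀ j, d i ≤ d j) (hfermat : f i = ∑ s, X s ^ d i) {c : Fin m → ℂ}
    (hc : ∑ s, c s • pderiv s (f i) ∈ Ideal.span (Set.range f)) : c = 0 := by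
  have hhom : (∑ s, c s • pderiv s (f i)).IsHomogeneous (d i - 1) :=
    Submodule.sum_mem (homogeneousSubmodule (Fin m) ℂ (d i - 1)) fun s _ =>
      Submodule.smul_mem _ _ (hf i).pderiv
  have h0 := homogeneousComponent_eq_zero_of_mem_span hf (q := d i - 1)
    (fun j => by have := hmin j; omega) hc
  rw [homogeneousComponent_eq_self hhom] at h0
  have hpd (s : Fin m) : pderiv s (f i) = (d i : MvPolynomial (Fin m) ℂ) * X s ^ (d i - 1) := by
    rw [hfermat, map_sum, Finset.sum_eq_single s]
    · simp
    · intro t _ hts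
      simp [pderiv_X_of_ne hts]
    · simp
  ext t
  have ht := congrArg (coeff (Finsupp.single t (d i - 1))) h0
  have hinj (s : Fin m) :
      Finsupp.single s (d i - 1) = Finsupp.single t (d i - 1) ↔ s = t :=
    Finsupp.single_left_inj (by omega)
  have hcast : (d i : MvPolynomial (Fin m) ℂ) = C (d i : ℂ) := by simp
  simp only [hpd, hcast, coeff_sum, coeff_smul, coeff_C_mul, coeff_X_pow, hinj, coeff_zero,
    smul_eq_mul, mul_ite, mul_one, mul_zero, Finset.sum_ite_eq', Finset.mem_univ, if_true] at ht
  have hdi : (d i : ℂ) ≠ 0 := by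
    rw [Nat.cast_ne_zero]
    omega
  simpa [hdi] using ht

variable {N k : ℕ}

/-- The constant linear combinations of the rows of the Jacobian matrix of `f`. -/
def jacobianMap (f : Fin k → MvPolynomial (Fin (N + k + 1)) ℂ) :
    (Fin (N + k + 1) → ℂ) →ₗ[ℂ] (Fin k → MvPolynomial (Fin (N + k + 1)) ℂ) :=
  Fintype.linearCombination ℂ fun s j => pderiv s (f j)

lemma jacobianMap_apply (f : Fin k → MvPolynomial (Fin (N + k + 1)) ℂ)
    (c : Fin (N + k + 1) → ℂ) (j : Fin k) :
    jacobianMap f c j = ∑ s, c s • pderiv s (f j) := by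
  simp [jacobianMap, Fintype.linearCombination_apply]

lemma pi_inf_ker_linearInW {d : Fin k → ℕ}
    {f : Fin k → MvPolynomial (Fin (N + k + 1)) ℂ} (hf : ∀ j, (f j).IsHomogeneous (d j)) :
    (Submodule.pi Set.univ fun j => homogeneousSubmodule (Fin (N + k + 1)) ℂ (d j - 1)) ⊓
        LinearMap.ker ((Ideal.Quotient.mkₐ ℂ (Jfull N k f)).toLinearMap ∘ₗ linearInW N k) =
      (Submodule.pi Set.univ fun j => (Ideal.span (Set.range f)).restrictScalars ℂ ⊓
        homogeneousSubmodule (Fin (N + k + 1)) ℂ (d j - 1)) ⊔ LinearMap.range (jacobianMap f) := by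
  have hker (g : Fin k → MvPolynomial (Fin (N + k + 1)) ℂ) :
      g ∈ LinearMap.ker ((Ideal.Quotient.mkₐ ℂ (Jfull N k f)).toLinearMap ∘ₗ linearInW N k) ↔
        linearInW N k g ∈ Jfull N k f := by
    rw [LinearMap.mem_ker]
    exact Ideal.Quotient.eq_zero_iff_mem
  have hrange (c : Fin (N + k + 1) → ℂ) (j : Fin k) :
      jacobianMap f c j ∈ homogeneousSubmodule (Fin (N + k + 1)) ℂ (d j - 1) := by
    rw [jacobianMap_apply]
    exact sum_mem fun s _ => Submodule.smul_mem _ _ (hf j).pderiv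
  apply le_antisymm
  · rintro g ⟨hg, hgJ⟩
    obtain ⟨b, hb⟩ := linearInW_mem_Jfull_iff.mp ((hker g).mp hgJ)
    set c : Fin (N + k + 1) → ℂ := fun s => coeff 0 (b s) with hc
    have hcomp (j : Fin k) : g j - jacobianMap f c j =
        homogeneousComponent (d j - 1) (g j - ∑ s, b s * pderiv s (f j)) := by
      rw [map_sub, homogeneousComponent_eq_self (hg j trivial), map_sum, jacobianMap_apply]
      congr 1
      refine Finset.sum_congr rfl fun s _ => ?_
      rw [homogeneousComponent_mul_of_isHomogeneous (hf j).pderiv, if_pos le_rfl, Nat.sub_self,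
        homogeneousComponent_zero, smul_eq_C_mul]
    rw [← sub_add_cancel g (jacobianMap f c)]
    refine Submodule.add_mem_sup (fun j _ => ⟨?_, ?_⟩) ⟨c, rfl⟩
    · rw [Pi.sub_apply, hcomp]
      have hI := isHomogeneous_span_image hf Set.univ
      rw [Set.image_univ] at hI
      exact homogeneousComponent_mem_of_mem hI (hb j) _
    · exact sub_mem (hg j trivial) (hrange c j)
  · refine sup_le (fun g hg => ⟨fun j _ => (hg j trivial).2, ?_⟩) ?_
    · rw [SetLike.mem_coe, hker, linearInW_mem_Jfull_iff]
      exact ⟨0, fun j => by simpa using (hg j trivial).1⟩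
    · rintro _ ⟨c, rfl⟩
      refine ⟨fun j _ => hrange c j, ?_⟩
      rw [SetLike.mem_coe, hker, linearInW_mem_Jfull_iff]
      exact ⟨fun s => C (c s), fun j => by simp [jacobianMap_apply, smul_eq_C_mul]⟩

lemma finrank_Rcomp_eq_sum_hilbertFunction {d : Fin k → ℕ} (hd : ∀ j, 1 ≤ d j)
    {f : Fin k → MvPolynomial (Fin (N + k + 1)) ℂ} (hf : ∀ j, (f j).IsHomogeneous (d j))
    {i : Fin k} (hi : 2 ≤ d i) (hmin : ∀ j, d i ≤ d j) (hfermat : f i = ∑ s, X s ^ d i) :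
    (Module.finrank ℂ (Rcomp N k d f 1 (-1)) : ℤ) =
      ∑ j, hilbertFunction (Ideal.span (Set.range f)) (d j - 1) - (N + k + 1) := by
  have hzero {c : Fin (N + k + 1) → ℂ}
      (hc : jacobianMap f c i ∈ Ideal.span (Set.range f)) : c = 0 := by
    rw [jacobianMap_apply] at hc
    exact eq_zero_of_sum_smul_pderiv_mem_span hf hi hmin hfermat hc
  have hinj : Function.Injective (jacobianMap f) := by
    rw [injective_iff_map_eq_zero]
    intro c hc
    exact hzero (by simp [hc])
  have hfinI (j : Fin k) : Module.Finite ℂ ↥((Ideal.span (Set.range f)).restrictScalars ℂ ⊓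
      homogeneousSubmodule (Fin (N + k + 1)) ℂ (d j - 1)) :=
    Submodule.finiteDimensional_of_le inf_le_right
  set V := Submodule.pi Set.univ fun j =>
    homogeneousSubmodule (Fin (N + k + 1)) ℂ (d j - 1) with hV
  set U := Submodule.pi Set.univ fun j => (Ideal.span (Set.range f)).restrictScalars ℂ ⊓
    homogeneousSubmodule (Fin (N + k + 1)) ℂ (d j - 1) with hU
  have : Module.Finite ℂ V := Module.Finite.equiv (submodulePiEquiv _).symm
  have : Module.Finite ℂ U := Module.Finite.equiv (submodulePiEquiv _).symm
  have hdisj : U ⊓ LinearMap.range (jacobianMap f) = ⊥ := by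
    rw [eq_bot_iff]
    rintro _ ⟨hg, c, rfl⟩
    rw [hzero (hg i trivial).1, map_zero]
    exact zero_mem _
  have hdim := finrank_map_add_finrank_inf_ker
    ((Ideal.Quotient.mkₐ ℂ (Jfull N k f)).toLinearMap ∘ₗ linearInW N k) V
  have hsup := Submodule.finrank_sup_add_finrank_inf_eq U (LinearMap.range (jacobianMap f))
  rw [hdisj, finrank_bot, LinearMap.finrank_range_of_inj hinj, Module.finrank_fin_fun] at hsup
  rw [pi_inf_ker_linearInW hf, Submodule.map_comp, ← Scomp_one_neg_one hd,
    finrank_submodule_pi] at hdim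
  rw [finrank_submodule_pi] at hsup
  simp only [hilbertFunction, Finset.sum_sub_distrib]
  change (Module.finrank ℂ ((Scomp N k d 1 (-1)).map
    (Ideal.Quotient.mkₐ ℂ (Jfull N k f)).toLinearMap) : ℤ) = _
  zify at hdim hsup
  linarith

end Jacobian

/-- **Proposition 3.5, second case.** If `f_1,…,f_k` is a regular sequence with
`i(X) = N+k+1-∑ d_j = 1`, `2 ≤ d_1 ≤ d_j` for all `j`, and
`f_1 = z_1^{d_1} + ⋯ + z_{N+k+1}^{d_1}`, then
`dim_ℂ R_{1,-1} = -(N+k+1) + ∑_{j=1}^{k} ∑_{I⊆{1,…,k}} (-1)^{k-|I|} C((∑_{s∈I} d_s)+d_j-1, N+k)`. -/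
theorem finrank_Rcomp_eq_index_one (N k : ℕ) (hN : 1 ≤ N) (hk : 1 ≤ k)
    (d : Fin k → ℕ) (hd : ∀ j, 1 ≤ d j)
    (f : Fin k → MvPolynomial (Fin (N + k + 1)) ℂ)
    (hfhom : ∀ j, (f j).IsHomogeneous (d j))
    (hfreg : IsRegularSeq f)
    (hiX : N + k + 1 - (∑ j : Fin k, d j) = 1)
    (hd1 : 2 ≤ d ⟨0, hk⟩) (hmin : ∀ j, d ⟨0, hk⟩ ≤ d j)
    (hf1 : f ⟨0, hk⟩ = ∑ s : Fin (N + k + 1), (X s : MvPolynomial (Fin (N + k + 1)) ℂ) ^ d ⟨0, hk⟩) :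
    (Module.finrank ℂ (Rcomp N k d f 1 (-1)) : ℤ)
      = -(N + k + 1) + ∑ j : Fin k, ∑ I ∈ (Finset.univ : Finset (Fin k)).powerset,
          (-1 : ℤ) ^ (k - I.card) *
            Nat.choose ((∑ s ∈ I, d s) + d j - 1) (N + k) := by
  rw [finrank_Rcomp_eq_sum_hilbertFunction hd hfhom hd1 hmin hf1, sub_eq_neg_add]
  congr 1
  refine Finset.sum_congr rfl fun j _ => ?_
  rw [hfreg.hilbertFunction_eq_sum_choose hfhom hd (by omega)]
  refine Finset.sum_congr rfl fun I _ => ?_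
  rw [Nat.add_sub_assoc (hd j)]
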